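/- arXiv:1109.2281 — 2 statements merged into one kernel-verified Lean document; each statement's English description precedes it below -/
import Mathlib

section
/- For all vectors u, v, w in ℝ^8, the squared norm of P(u,v,w) equals the Gram determinant of u, v, w: ‖P(u,v,w)‖² = det( (⟨u,u⟩, ⟨u,v⟩, ⟨u,w⟩), (⟨v,u⟩, ⟨v,v⟩, ⟨v,w⟩), (⟨w,u⟩, ⟨w,v⟩, ⟨w,w⟩) ). Thus P is a vector cross product of rank 3 on ℝ^8. -/
open RealInnerProductSpace

noncomputable section

/-- Euclidean space `ℝ^8`. -/
abbrev E8 : Type := EuclideanSpace ℝ (Fin 8)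

/-- The standard orthonormal basis vectors `e_0, …, e_7` of `ℝ^8`. -/
def e (i : Fin 8) : E8 := EuclideanSpace.single i 1

/-- The elementary alternating 4-form `e^i ∧ e^j ∧ e^k ∧ e^l` evaluated on `(u,v,w,x)`. -/
def wedge4 (i j k l : Fin 8) (u v w x : E8) : ℝ :=
  Matrix.det !![u i, u j, u k, u l;
                v i, v j, v k, v l;
                w i, w j, w k, w l;
                x i, x j, x k, x l]

/-- The standard `Spin(7)`-form `φ₀` on `ℝ^8`:
`φ₀ = e^{0145}+e^{0167}+e^{2345}+e^{2367}+e^{0246}−e^{0257}−e^{1346}+e^{1357}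
     −e^{0347}−e^{0356}−e^{1247}−e^{1256}+e^{0123}+e^{4567}`. -/
def phi0 (u v w x : E8) : ℝ :=
    wedge4 0 1 4 5 u v w x + wedge4 0 1 6 7 u v w x + wedge4 2 3 4 5 u v w x
  + wedge4 2 3 6 7 u v w x + wedge4 0 2 4 6 u v w x - wedge4 0 2 5 7 u v w x
  - wedge4 1 3 4 6 u v w x + wedge4 1 3 5 7 u v w x - wedge4 0 3 4 7 u v w x
  - wedge4 0 3 5 6 u v w x - wedge4 1 2 4 7 u v w x - wedge4 1 2 5 6 u v w x
  + wedge4 0 1 2 3 u v w x + wedge4 4 5 6 7 u v w x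

/-- The triple cross product `P : ℝ^8 × ℝ^8 × ℝ^8 → ℝ^8`, determined by
`⟨P(u,v,w), x⟩ = φ₀(u,v,w,x)` for all `x ∈ ℝ^8`. -/
def P (u v w : E8) : E8 :=
  (WithLp.equiv 2 (Fin 8 → ℝ)).symm (fun i => phi0 u v w (e i))

set_option maxHeartbeats 0
set_option maxRecDepth 100000

theorem wedge4_expand (i j k l : Fin 8) (u v w x : E8) : wedge4 i j k l u v w x =
    x l * (u i * (v j * w k - v k * w j) - u j * (v i * w k - v k * w i) + u k * (v i * w j - v j * w i))
  - x k * (u i * (v j * w l - v l * w j) - u j * (v i * w l - v l * w i) + u l * (v i * w j - v j * w i))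
  + x j * (u i * (v k * w l - v l * w k) - u k * (v i * w l - v l * w i) + u l * (v i * w k - v k * w i))
  - x i * (u j * (v k * w l - v l * w k) - u k * (v j * w l - v l * w j) + u l * (v j * w k - v k * w j)) := by
  unfold wedge4
  simp [Matrix.det_succ_row_zero, Fin.sum_univ_succ, Fin.succAbove]
  ring

/-- `‖P(u,v,w)‖²` equals the Gram determinant of `u, v, w`;
thus `P` is a vector cross product of rank 3 on `ℝ^8`. -/
theorem P_norm_sq_eq_gram_det (u v w : E8) :
    ‖P u v w‖ ^ 2 =
      Matrix.det !![⟪u, u⟫, ⟪u, v⟫, ⟪u, w⟫;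
                    ⟪v, u⟫, ⟪v, v⟫, ⟪v, w⟫;
                    ⟪w, u⟫, ⟪w, v⟫, ⟪w, w⟫] := by
  rw [EuclideanSpace.norm_sq_eq, Matrix.det_fin_three]
  simp only [P, phi0, wedge4_expand, e, WithLp.equiv_symm_apply, Fin.sum_univ_eight, Real.norm_eq_abs, sq_abs,
    PiLp.inner_apply, PiLp.single_apply, Matrix.of_apply, Matrix.cons_val', Matrix.cons_val_zero, Matrix.cons_val_one,
    Matrix.cons_val, RCLike.inner_apply, conj_trivial, Fin.reduceEq, if_true, if_false,
    zero_mul, one_mul, add_zero, zero_add, sub_zero, zero_sub]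
  generalize u 0 = u0, u 1 = u1, u 2 = u2, u 3 = u3, u 4 = u4, u 5 = u5, u 6 = u6, u 7 = u7,
    v 0 = v0, v 1 = v1, v 2 = v2, v 3 = v3, v 4 = v4, v 5 = v5, v 6 = v6, v 7 = v7,
    w 0 = w0, w 1 = w1, w 2 = w2, w 3 = w3, w 4 = w4, w 5 = w5, w 6 = w6, w 7 = w7
  ring
end
end

section
/- For all a, b, u, v, w ∈ ℝ^8 the following composition rule for iterated cross products holds: P(a,b,P(u,v,w)) = −G(a,b,u,v)·w − φ₀(a,b,u,v)·w + ⟨b,w⟩P(a,u,v) − ⟨a,w⟩P(b,u,v) − G(a,b,v,w)·u − φ₀(a,b,v,w)·u + ⟨b,u⟩P(a,v,w) − ⟨a,u⟩P(b,v,w) − G(a,b,w,u)·v − φ₀(a,b,w,u)·v + ⟨b,v⟩P(a,w,u) − ⟨a,v⟩P(b,w,u), where G(a,b,x,y) := ⟨a,x⟩⟨b,y⟩ − ⟨a,y⟩⟨b,x⟩. -/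
open RealInnerProductSpace

noncomputable section

lemma wedge4_eq (i j k l : Fin 8) (u v w x : E8) : wedge4 i j k l u v w x =
    (u i * v j - u j * v i) * (w k * x l - w l * x k)
  - (u i * v k - u k * v i) * (w j * x l - w l * x j)
  + (u i * v l - u l * v i) * (w j * x k - w k * x j)
  + (u j * v k - u k * v j) * (w i * x l - w l * x i)
  - (u j * v l - u l * v j) * (w i * x k - w k * x i)
  + (u k * v l - u l * v k) * (w i * x j - w j * x i) := by
  simp [wedge4, Matrix.det_succ_row_zero, Fin.sum_univ_succ, Fin.succAbove]
  ring

lemma P_apply (u v w : E8) (i : Fin 8) : P u v w i = phi0 u v w (e i) := rfl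

lemma e_apply (i j : Fin 8) : e i j = if j = i then 1 else 0 := by
  simp [e]

lemma inner8 (u v : E8) : ⟪u, v⟫ = u 0 * v 0 + u 1 * v 1 + u 2 * v 2 + u 3 * v 3
    + u 4 * v 4 + u 5 * v 5 + u 6 * v 6 + u 7 * v 7 := by
  simp [PiLp.inner_apply, Fin.sum_univ_eight]
  ring

/-- Translation of the index set `Fin 8 = (ℤ/2)^3` by `k` (bitwise xor). -/
def xr (k i : Fin 8) : Fin 8 := i ^^^ k

lemma xr_xr (k i : Fin 8) : xr k (xr k i) = i := by
  revert k i; decide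

lemma xr_zero (k : Fin 8) : xr k 0 = k := by
  revert k; decide

/-- The coordinate permutation of `ℝ^8` induced by `xr k`; it preserves `phi0`. -/
def S (k : Fin 8) (x : E8) : E8 := WithLp.toLp 2 (fun i => x (xr k i))

lemma S_apply (k : Fin 8) (x : E8) (i : Fin 8) : S k x i = x (xr k i) := rfl

lemma S_e (k i : Fin 8) : S k (e (xr k i)) = e i := by
  ext j
  rw [S_apply, e_apply, e_apply]
  congr 1
  revert k i j
  simp only [eq_iff_iff]
  decide

lemma inner_S (k : Fin 8) (u v : E8) : ⟪S k u, S k v⟫ = ⟪u, v⟫ := by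
  simp only [PiLp.inner_apply, S_apply]
  exact Equiv.sum_comp (⟨xr k, xr k, xr_xr k, xr_xr k⟩ : Equiv.Perm (Fin 8))
    (fun i => inner ℝ (u i) (v i))

lemma S_S (j k : Fin 8) (x : E8) : S (xr j k) x = S j (S k x) := by
  have h : ∀ j k i : Fin 8, xr (xr j k) i = xr k (xr j i) := by decide
  ext i
  simp only [S_apply, h]

lemma S_zero (x : E8) : S 0 x = x := by
  have h : ∀ i : Fin 8, xr 0 i = i := by decide
  ext i
  rw [S_apply, h]

lemma phi0_S_gen (k : Fin 8) (hk : k = 1 ∨ k = 2 ∨ k = 4) (u v w x : E8) :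
    phi0 (S k u) (S k v) (S k w) (S k x) = phi0 u v w x := by
  rcases hk with rfl | rfl | rfl
  all_goals
    simp only [phi0, wedge4_eq, S_apply, xr, Fin.reduceXor]
    ring

lemma phi0_S (k : Fin 8) (u v w x : E8) :
    phi0 (S k u) (S k v) (S k w) (S k x) = phi0 u v w x := by
  have hk : ∃ p q r : Fin 8, k = xr p (xr q r) ∧ (p = 0 ∨ p = 1) ∧ (q = 0 ∨ q = 2)
      ∧ (r = 0 ∨ r = 4) := by
    revert k; decide
  obtain ⟨p, q, r, rfl, hp, hq, hr⟩ := hk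
  have gen : ∀ k : Fin 8, (k = 0 ∨ k = 1 ∨ k = 2 ∨ k = 4) → ∀ u v w x : E8,
      phi0 (S k u) (S k v) (S k w) (S k x) = phi0 u v w x := by
    intro k hk u v w x
    rcases hk with rfl | hk
    · simp only [S_zero]
    · exact phi0_S_gen k hk u v w x
  simp only [S_S]
  rw [gen p (by tauto), gen q (by tauto), gen r (by tauto)]

lemma P_S (k : Fin 8) (u v w : E8) : P (S k u) (S k v) (S k w) = S k (P u v w) := by
  ext i
  rw [S_apply, P_apply, P_apply, ← S_e k i, phi0_S]

set_option maxHeartbeats 0 in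
set_option maxRecDepth 100000 in
lemma P_zero (u v w : E8) : P u v w 0 = -(u 1 * (v 4 * w 5 - v 5 * w 4) - u 4 * (v 1 * w 5 - v 5 * w 1) + u 5 * (v 1 * w 4 - v 4 * w 1))
    - (u 1 * (v 6 * w 7 - v 7 * w 6) - u 6 * (v 1 * w 7 - v 7 * w 1) + u 7 * (v 1 * w 6 - v 6 * w 1))
    - (u 2 * (v 4 * w 6 - v 6 * w 4) - u 4 * (v 2 * w 6 - v 6 * w 2) + u 6 * (v 2 * w 4 - v 4 * w 2))
    + (u 2 * (v 5 * w 7 - v 7 * w 5) - u 5 * (v 2 * w 7 - v 7 * w 2) + u 7 * (v 2 * w 5 - v 5 * w 2))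
    + (u 3 * (v 4 * w 7 - v 7 * w 4) - u 4 * (v 3 * w 7 - v 7 * w 3) + u 7 * (v 3 * w 4 - v 4 * w 3))
    + (u 3 * (v 5 * w 6 - v 6 * w 5) - u 5 * (v 3 * w 6 - v 6 * w 3) + u 6 * (v 3 * w 5 - v 5 * w 3))
    - (u 1 * (v 2 * w 3 - v 3 * w 2) - u 2 * (v 1 * w 3 - v 3 * w 1) + u 3 * (v 1 * w 2 - v 2 * w 1)) := by
  simp [P_apply, phi0, wedge4_eq, e_apply, -mul_eq_mul_left_iff, -mul_eq_mul_right_iff]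
  ring

lemma P_comp (u v w : E8) (k : Fin 8) : P u v w k = P (S k u) (S k v) (S k w) 0 := by
  rw [P_S, S_apply, xr_zero]

set_option maxHeartbeats 0 in
set_option maxRecDepth 100000 in
lemma rule_zero (a b u v w : E8) :
    P a b (P u v w) 0 =
        -((⟪a, u⟫ * ⟪b, v⟫ - ⟪a, v⟫ * ⟪b, u⟫) * w 0) - phi0 a b u v * w 0
        + ⟪b, w⟫ * P a u v 0 - ⟪a, w⟫ * P b u v 0
        - ((⟪a, v⟫ * ⟪b, w⟫ - ⟪a, w⟫ * ⟪b, v⟫) * u 0) - phi0 a b v w * u 0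
        + ⟪b, u⟫ * P a v w 0 - ⟪a, u⟫ * P b v w 0
        - ((⟪a, w⟫ * ⟪b, u⟫ - ⟪a, u⟫ * ⟪b, w⟫) * v 0) - phi0 a b w u * v 0
        + ⟪b, v⟫ * P a w u 0 - ⟪a, v⟫ * P b w u 0 := by
  rw [P_zero a b (P u v w)]
  simp only [P_comp u v w 1, P_comp u v w 2, P_comp u v w 3, P_comp u v w 4, P_comp u v w 5,
    P_comp u v w 6, P_comp u v w 7, P_zero, S_apply, xr, Fin.reduceXor, inner8, phi0, wedge4_eq]
  ring

/-- Composition rule for iterated cross products, where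
`G(a,b,x,y) = ⟨a,x⟩⟨b,y⟩ − ⟨a,y⟩⟨b,x⟩`. -/
theorem P_composition_rule (a b u v w : E8) :
    P a b (P u v w) =
        -((⟪a, u⟫ * ⟪b, v⟫ - ⟪a, v⟫ * ⟪b, u⟫) • w) - phi0 a b u v • w
        + ⟪b, w⟫ • P a u v - ⟪a, w⟫ • P b u v
        - ((⟪a, v⟫ * ⟪b, w⟫ - ⟪a, w⟫ * ⟪b, v⟫) • u) - phi0 a b v w • u
        + ⟪b, u⟫ • P a v w - ⟪a, u⟫ • P b v w
        - ((⟪a, w⟫ * ⟪b, u⟫ - ⟪a, u⟫ * ⟪b, w⟫) • v) - phi0 a b w u • v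
        + ⟪b, v⟫ • P a w u - ⟪a, v⟫ • P b w u := by
  ext k
  have h := rule_zero (S k a) (S k b) (S k u) (S k v) (S k w)
  simp only [P_S, inner_S, phi0_S, S_apply, xr_zero] at h
  simp only [PiLp.add_apply, PiLp.sub_apply, PiLp.neg_apply, PiLp.smul_apply, smul_eq_mul]
  exact h
end
end
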